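/- arXiv:2503.06838 — 2 statements merged into one kernel-verified Lean document; each statement's English description precedes it below -/
import Mathlib

section
/- Continuity of the alignment value: Under the compact setup, the map (μ, ν) ↦ W_c^{↓,R}(μ,ν) is jointly continuous on P(X) × P(Z), where both spaces of Borel probability measures carry the topology of weak convergence. -/
open MeasureTheory

/-- The optimal transport cost between two measures on `Z` for cost `c`. -/
noncomputable def transportCost {Z : Type*} [MeasurableSpace Z]
    (c : Z × Z → ℝ) (α β : Measure Z) : ℝ :=
  sInf { v : ℝ | ∃ π : Measure (Z × Z),
    π.map Prod.fst = α ∧ π.map Prod.snd = β ∧ v = ∫ p, c p ∂π }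

/-- The penalized Wasserstein alignment value `W_c^{↓,R}(μ,ν)`. -/
noncomputable def alignVal {X Θ Z : Type*} [MeasurableSpace X] [MeasurableSpace Z]
    (c : Z × Z → ℝ) (T : Θ → X → Z) (R : Θ → ℝ)
    (μ : Measure X) (ν : Measure Z) : ℝ :=
  ⨅ θ : Θ, (transportCost c (μ.map (T θ)) ν + R θ)

open Filter Topology

lemma av_int {Y : Type*} [TopologicalSpace Y] [CompactSpace Y] [MeasurableSpace Y]
    [OpensMeasurableSpace Y] (μ : Measure Y) [IsFiniteMeasure μ] {f : Y → ℝ}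
    (hf : Continuous f) : Integrable f μ :=
  (BoundedContinuousFunction.mkOfCompact ⟨f, hf⟩).integrable μ

lemma av_pou {Z : Type*} [MetricSpace Z] [CompactSpace Z] (δ : ℝ) (hδ : 0 < δ) :
    ∃ (t : Finset Z) (φ : t → Z → ℝ), (∀ i, Continuous (φ i)) ∧ (∀ i x, 0 ≤ φ i x) ∧
      (∀ x, ∑ i, φ i x = 1) ∧ ∀ i x, φ i x ≠ 0 → dist x (i : Z) < δ := by
  obtain ⟨t, ht⟩ := isCompact_univ.elim_finite_subcover (fun z : Z => Metric.ball z δ)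
    (fun z => Metric.isOpen_ball)
    (fun z _ => Set.mem_iUnion.2 ⟨z, Metric.mem_ball_self hδ⟩)
  obtain ⟨f, hf⟩ := PartitionOfUnity.exists_isSubordinate (isClosed_univ (X := Z))
    (fun i : t => Metric.ball (i : Z) δ) (fun i => Metric.isOpen_ball) (by
      intro x hx
      have := ht hx
      simp only [Set.mem_iUnion] at this ⊢
      obtain ⟨i, hi, h⟩ := this
      exact ⟨⟨i, hi⟩, h⟩)
  refine ⟨t, fun i => f i, fun i => (f i).continuous, fun i x => f.nonneg i x, fun x => ?_, ?_⟩
  · rw [← finsum_eq_sum_of_fintype]; exact f.sum_eq_one (Set.mem_univ x)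
  · intro i x hx
    exact hf i (subset_tsupport _ hx)

lemma av_fst {Z : Type*} [MetricSpace Z] [CompactSpace Z] [MeasurableSpace Z] [BorelSpace Z]
    (α β : Measure Z) [IsProbabilityMeasure α] [IsProbabilityMeasure β]
    (H : Z × Z → ℝ) (hH : Continuous H) (h0 : ∀ p, 0 ≤ H p)
    (h1 : ∀ x, ∫ y, H (x, y) ∂β = 1) :
    ((α.prod β).withDensity fun p => ENNReal.ofReal (H p)).map Prod.fst = α := by
  ext s hs
  rw [Measure.map_apply measurable_fst hs, withDensity_apply _ (measurable_fst hs),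
    ← Set.prod_univ, ← Measure.prod_restrict, Measure.restrict_univ,
    lintegral_prod _ (by fun_prop)]
  have : ∀ x, ∫⁻ y, ENNReal.ofReal (H (x, y)) ∂β = 1 := by
    intro x
    rw [← ofReal_integral_eq_lintegral_ofReal, h1 x, ENNReal.ofReal_one]
    · exact av_int β (by fun_prop)
    · exact Eventually.of_forall fun y => h0 _
  simp [this]

lemma av_snd {Z : Type*} [MetricSpace Z] [CompactSpace Z] [MeasurableSpace Z] [BorelSpace Z]
    (α β : Measure Z) [IsProbabilityMeasure α] [IsProbabilityMeasure β]
    (H : Z × Z → ℝ) (hH : Continuous H) (h0 : ∀ p, 0 ≤ H p)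
    (h1 : ∀ y, ∫ x, H (x, y) ∂α = 1) :
    ((α.prod β).withDensity fun p => ENNReal.ofReal (H p)).map Prod.snd = β := by
  ext s hs
  rw [Measure.map_apply measurable_snd hs, withDensity_apply _ (measurable_snd hs),
    ← Set.univ_prod, ← Measure.prod_restrict, Measure.restrict_univ,
    lintegral_prod_symm _ (by fun_prop)]
  have : ∀ y, ∫⁻ x, ENNReal.ofReal (H (x, y)) ∂α = 1 := by
    intro y
    rw [← ofReal_integral_eq_lintegral_ofReal, h1 y, ENNReal.ofReal_one]
    · exact av_int α (by fun_prop)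
    · exact Eventually.of_forall fun y => h0 _
  simp [this]

/-- The density. -/
noncomputable def avH {Z ι : Type*} [Fintype ι] (ε : ℝ) (φ : ι → Z → ℝ) (a a' b b' : ι → ℝ)
    (m : ι → ι → ℝ) (x y : Z) : ℝ :=
  (1 - ε) * (∑ i, ∑ j, m i j / (a' i * b' j) * (φ i x * φ j y)) +
    (1 - (1 - ε) * ∑ i, a i / a' i * φ i x) * (1 - (1 - ε) * ∑ j, b j / b' j * φ j y) / ε

lemma avH_symm {Z ι : Type*} [Fintype ι] (ε : ℝ) (φ : ι → Z → ℝ) (a a' b b' : ι → ℝ)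
    (m : ι → ι → ℝ) (x y : Z) :
    avH ε φ a a' b b' m x y = avH ε φ b b' a a' (fun i j => m j i) y x := by
  unfold avH
  rw [Finset.sum_comm]
  simp only [mul_comm (b' _) (a' _), mul_comm (φ _ y) (φ _ x)]
  ring

lemma av_sum_int {Z ι : Type*} [Fintype ι] [MetricSpace Z] [CompactSpace Z] [MeasurableSpace Z]
    [BorelSpace Z] (β : Measure Z) [IsProbabilityMeasure β]
    (φ : ι → Z → ℝ) (hφ : ∀ i, Continuous (φ i)) (k : ι → ℝ) :
    ∫ y, ∑ j, k j * φ j y ∂β = ∑ j, k j * ∫ y, φ j y ∂β := by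
  rw [integral_finsetSum]
  · simp only [integral_const_mul]
  · intro i _
    exact av_int β ((hφ i).const_mul _)

lemma avH_int {Z ι : Type*} [Fintype ι] [MetricSpace Z] [CompactSpace Z] [MeasurableSpace Z]
    [BorelSpace Z] (β : Measure Z) [IsProbabilityMeasure β] (ε : ℝ) (hε : 0 < ε)
    (φ : ι → Z → ℝ) (hφ : ∀ i, Continuous (φ i)) (a a' b b' : ι → ℝ)
    (m : ι → ι → ℝ) (hb' : ∀ j, b' j = ∫ y, φ j y ∂β) (hbz : ∀ j, b' j = 0 → b j = 0)
    (hmz : ∀ i j, b j = 0 → m i j = 0) (hb1 : ∑ j, b j = 1) (hma : ∀ i, ∑ j, m i j = a i)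
    (x : Z) : ∫ y, avH ε φ a a' b b' m x y ∂β = 1 := by
  have e1 : ∀ y, ∑ i, ∑ j, m i j / (a' i * b' j) * (φ i x * φ j y)
      = ∑ j, (∑ i, m i j / (a' i * b' j) * φ i x) * φ j y := by
    intro y
    rw [Finset.sum_comm]
    simp only [Finset.sum_mul, mul_assoc]
  unfold avH
  simp only [e1]
  have c1 : Continuous fun y => ∑ j, (∑ i, m i j / (a' i * b' j) * φ i x) * φ j y := by fun_prop
  have c2 : Continuous fun y => ∑ j, b j / b' j * φ j y := by fun_prop
  have i2 : ∫ y, ∑ j, b j / b' j * φ j y ∂β = 1 := by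
    rw [av_sum_int β φ hφ, ← hb1]
    refine Finset.sum_congr rfl fun j _ => ?_
    rw [← hb' j]
    by_cases h : b' j = 0
    · simp [h, hbz j h]
    · field_simp
  have i1 : ∫ y, ∑ j, (∑ i, m i j / (a' i * b' j) * φ i x) * φ j y ∂β
      = ∑ i, a i / a' i * φ i x := by
    rw [av_sum_int β φ hφ]
    simp only [Finset.sum_mul]
    rw [Finset.sum_comm]
    refine Finset.sum_congr rfl fun i _ => ?_
    rw [← hma i, Finset.sum_div, Finset.sum_mul]
    refine Finset.sum_congr rfl fun j _ => ?_
    rw [← hb' j]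
    by_cases h : b' j = 0
    · simp [h, hmz i j (hbz j h)]
    · rw [← div_div]; field_simp
  rw [integral_add (av_int β (by fun_prop)) (av_int β (by fun_prop)), integral_const_mul, i1,
    integral_div, integral_const_mul, integral_sub (av_int β (by fun_prop)) (av_int β (by fun_prop)),
    integral_const_mul, i2]
  simp
  field_simp
  ring

lemma av_key {Z ι : Type*} [Fintype ι] [MetricSpace Z] [CompactSpace Z] [MeasurableSpace Z]
    [BorelSpace Z] (c : Z × Z → ℝ) (hc : Continuous c) (M ε : ℝ) (hM : ∀ p, |c p| ≤ M)
    (hε : 0 < ε) (hε1 : ε < 1)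
    (φ : ι → Z → ℝ) (hφ : ∀ i, Continuous (φ i)) (h0 : ∀ i x, 0 ≤ φ i x)
    (hs : ∀ x, ∑ i, φ i x = 1) (z : ι → Z)
    (hosc : ∀ i j x y, φ i x ≠ 0 → φ j y ≠ 0 → |c (x, y) - c (z i, z j)| ≤ ε)
    (π : Measure (Z × Z)) [IsProbabilityMeasure π]
    (α' β' : Measure Z) [IsProbabilityMeasure α'] [IsProbabilityMeasure β']
    (hα : ∀ i, (1 - ε) * ∫ x, φ i x ∂(π.map Prod.fst) ≤ ∫ x, φ i x ∂α')
    (hβ : ∀ i, (1 - ε) * ∫ x, φ i x ∂(π.map Prod.snd) ≤ ∫ x, φ i x ∂β') :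
    ∃ π' : Measure (Z × Z), π'.map Prod.fst = α' ∧ π'.map Prod.snd = β' ∧
      ∫ p, c p ∂π' ≤ ∫ p, c p ∂π + (2 + 2 * M) * ε := by
  obtain ⟨a, ha⟩ : ∃ a : ι → ℝ, ∀ i, a i = ∫ p, φ i p.1 ∂π := ⟨_, fun _ => rfl⟩
  obtain ⟨b, hb⟩ : ∃ a : ι → ℝ, ∀ i, a i = ∫ p, φ i p.2 ∂π := ⟨_, fun _ => rfl⟩
  obtain ⟨a', ha'⟩ : ∃ a : ι → ℝ, ∀ i, a i = ∫ x, φ i x ∂α' := ⟨_, fun _ => rfl⟩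
  obtain ⟨b', hb'⟩ : ∃ a : ι → ℝ, ∀ i, a i = ∫ x, φ i x ∂β' := ⟨_, fun _ => rfl⟩
  obtain ⟨m, hm⟩ : ∃ m : ι → ι → ℝ, ∀ i j, m i j = ∫ p, φ i p.1 * φ j p.2 ∂π :=
    ⟨_, fun _ _ => rfl⟩
  have hα2 : ∀ i, (1 - ε) * a i ≤ a' i := by
    intro i
    have := hα i
    rwa [integral_map measurable_fst.aemeasurable (hφ i).aestronglyMeasurable, ← ha, ← ha'] at this
  have hβ2 : ∀ i, (1 - ε) * b i ≤ b' i := by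
    intro i
    have := hβ i
    rwa [integral_map measurable_snd.aemeasurable (hφ i).aestronglyMeasurable, ← hb, ← hb'] at this
  have a0 : ∀ i, 0 ≤ a i := fun i => by rw [ha]; exact integral_nonneg fun p => h0 _ _
  have b0 : ∀ i, 0 ≤ b i := fun i => by rw [hb]; exact integral_nonneg fun p => h0 _ _
  have a0' : ∀ i, 0 ≤ a' i := fun i => by rw [ha']; exact integral_nonneg fun p => h0 _ _
  have b0' : ∀ i, 0 ≤ b' i := fun i => by rw [hb']; exact integral_nonneg fun p => h0 _ _
  have m0 : ∀ i j, 0 ≤ m i j := fun i j => by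
    rw [hm]; exact integral_nonneg fun p => mul_nonneg (h0 _ _) (h0 _ _)
  have haz : ∀ i, a' i = 0 → a i = 0 := fun i h => by
    have := hα2 i; have := a0 i; nlinarith
  have hbz : ∀ i, b' i = 0 → b i = 0 := fun i h => by
    have := hβ2 i; have := b0 i; nlinarith
  have hma : ∀ i, ∑ j, m i j = a i := by
    intro i
    simp only [hm, ha]
    rw [← integral_finsetSum _ fun j _ => av_int π (by fun_prop)]
    simp only [← Finset.mul_sum, hs, mul_one]
  have hmb : ∀ j, ∑ i, m i j = b j := by
    intro j
    simp only [hm, hb]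
    rw [← integral_finsetSum _ fun j _ => av_int π (by fun_prop)]
    simp only [← Finset.sum_mul, hs, one_mul]
  have hmaz : ∀ i j, a i = 0 → m i j = 0 := fun i j h =>
    (Finset.sum_eq_zero_iff_of_nonneg fun j _ => m0 i j).1 ((hma i).trans h) j (Finset.mem_univ _)
  have hmbz : ∀ i j, b j = 0 → m i j = 0 := fun i j h =>
    (Finset.sum_eq_zero_iff_of_nonneg fun i _ => m0 i j).1 ((hmb j).trans h) i (Finset.mem_univ _)
  have sa : ∑ i, a i = 1 := by
    simp only [ha]
    rw [← integral_finsetSum _ fun j _ => av_int π (by fun_prop)]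
    simp [hs]
  have sb : ∑ i, b i = 1 := by
    simp only [hb]
    rw [← integral_finsetSum _ fun j _ => av_int π (by fun_prop)]
    simp [hs]
  -- nonnegativity
  have hu : ∀ (a a' : ι → ℝ), (∀ i, (1 - ε) * a i ≤ a' i) → (∀ i, 0 ≤ a' i) →
      ∀ x, 0 ≤ 1 - (1 - ε) * ∑ i, a i / a' i * φ i x := by
    intro a a' h h' x
    rw [sub_nonneg, Finset.mul_sum]
    refine le_trans ?_ (hs x).le
    refine Finset.sum_le_sum fun i _ => ?_
    rw [← mul_assoc, ← mul_div_assoc]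
    exact mul_le_of_le_one_left (h0 i x) (div_le_one_of_le₀ (h i) (h' i))
  obtain ⟨r, hr⟩ : ∃ r : Z × Z → ℝ, ∀ p, r p = (1 - (1 - ε) * ∑ i, a i / a' i * φ i p.1) *
      (1 - (1 - ε) * ∑ j, b j / b' j * φ j p.2) / ε := ⟨_, fun _ => rfl⟩
  have r0 : ∀ p, 0 ≤ r p := fun p => by
    rw [hr]; exact div_nonneg (mul_nonneg (hu a a' hα2 a0' _) (hu b b' hβ2 b0' _)) hε.le
  have rc : Continuous r := by
    rw [funext hr]; fun_prop
  have hHr : ∀ p : Z × Z, avH ε φ a a' b b' m p.1 p.2 =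
      (1 - ε) * (∑ i, ∑ j, m i j / (a' i * b' j) * (φ i p.1 * φ j p.2)) + r p := fun p => by
    rw [hr]; rfl
  have H0 : ∀ p : Z × Z, 0 ≤ avH ε φ a a' b b' m p.1 p.2 := by
    intro p
    rw [hHr]
    refine add_nonneg (mul_nonneg (by linarith) (Finset.sum_nonneg fun i _ =>
      Finset.sum_nonneg fun j _ => mul_nonneg (div_nonneg (m0 i j) (mul_nonneg (a0' i) (b0' j)))
        (mul_nonneg (h0 _ _) (h0 _ _)))) (r0 p)
  have Hc : Continuous fun p : Z × Z => avH ε φ a a' b b' m p.1 p.2 := by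
    rw [funext hHr]; fun_prop
  refine ⟨(α'.prod β').withDensity fun p => ENNReal.ofReal (avH ε φ a a' b b' m p.1 p.2),
    av_fst _ _ (fun p => avH ε φ a a' b b' m p.1 p.2) Hc H0
      (fun x => avH_int β' ε hε φ hφ a a' b b' m hb' hbz hmbz sb hma x),
    av_snd _ _ (fun p => avH ε φ a a' b b' m p.1 p.2) Hc H0 (fun y => ?_), ?_⟩
  · simp only [avH_symm ε φ a a' b b' m]
    exact avH_int α' ε hε φ hφ b b' a a' (fun i j => m j i) ha' haz (fun i j => hmaz j i) sa hmb y
  rw [integral_withDensity_eq_integral_toReal_smul₀ (by fun_prop) (by simp)]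
  simp only [ENNReal.toReal_ofReal (H0 _), smul_eq_mul]
  -- integral of r
  have ir : ∫ p, r p ∂(α'.prod β') = ε := by
    have iu : ∀ (μ : Measure Z) [IsProbabilityMeasure μ] (a a' : ι → ℝ),
        (∀ i, a' i = ∫ x, φ i x ∂μ) → (∀ i, a' i = 0 → a i = 0) → ∑ i, a i = 1 →
        ∫ x, (1 - (1 - ε) * ∑ i, a i / a' i * φ i x) ∂μ = ε := by
      intro μ _ a a' h1 h2 h3
      rw [integral_sub (av_int μ (by fun_prop)) (av_int μ (by fun_prop)), integral_const_mul,
        av_sum_int μ φ hφ]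
      have : ∑ j, a j / a' j * ∫ y, φ j y ∂μ = 1 := by
        rw [← h3]
        refine Finset.sum_congr rfl fun j _ => ?_
        rw [← h1 j]
        by_cases h : a' j = 0
        · simp [h, h2 j h]
        · field_simp
      rw [this]; simp
    simp only [hr]
    rw [integral_div, integral_prod_mul (fun x => 1 - (1 - ε) * ∑ i, a i / a' i * φ i x)
      (fun y => 1 - (1 - ε) * ∑ i, b i / b' i * φ i y), iu α' a a' ha' haz sa, iu β' b b' hb' hbz sb]
    field_simp
  -- upper bound
  have up : ∫ p, avH ε φ a a' b b' m p.1 p.2 * c p ∂(α'.prod β') ≤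
      (1 - ε) * (∑ i, ∑ j, m i j * (c (z i, z j) + ε)) + M * ε := by
    have e : (1 - ε) * (∑ i, ∑ j, m i j * (c (z i, z j) + ε)) + M * ε =
        ∫ p, ((1 - ε) * (∑ i, ∑ j, m i j / (a' i * b' j) * (c (z i, z j) + ε) *
          (φ i p.1 * φ j p.2)) + M * r p) ∂(α'.prod β') := by
      rw [integral_add (av_int _ (by fun_prop)) (av_int _ (by fun_prop)), integral_const_mul,
        integral_const_mul, ir, integral_finsetSum _ fun i _ => av_int _ (by fun_prop)]
      congr 2
      refine Finset.sum_congr rfl fun i _ => ?_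
      rw [integral_finsetSum _ fun i _ => av_int _ (by fun_prop)]
      refine Finset.sum_congr rfl fun j _ => ?_
      rw [integral_const_mul, integral_prod_mul (φ i) (φ j), ← ha', ← hb']
      by_cases h : a' i = 0
      · simp [h, hmaz i j (haz i h)]
      by_cases h' : b' j = 0
      · simp [h', hmbz i j (hbz j h')]
      field_simp
    rw [e]
    refine integral_mono (av_int _ (by fun_prop)) (av_int _ (by fun_prop)) fun p => ?_
    simp only [hHr, add_mul]
    refine add_le_add ?_ ?_
    · rw [mul_assoc]
      refine mul_le_mul_of_nonneg_left ?_ (by linarith)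
      rw [Finset.sum_mul]
      refine Finset.sum_le_sum fun i _ => ?_
      rw [Finset.sum_mul]
      refine Finset.sum_le_sum fun j _ => ?_
      rw [mul_assoc (m i j / _) (φ i p.1 * φ j p.2), mul_assoc (m i j / _) (c (z i, z j) + ε)]
      refine mul_le_mul_of_nonneg_left ?_ (div_nonneg (m0 i j) (mul_nonneg (a0' i) (b0' j)))
      by_cases h : φ i p.1 = 0
      · simp [h]
      by_cases h' : φ j p.2 = 0
      · simp [h']
      rw [mul_comm]
      refine mul_le_mul_of_nonneg_right ?_ (mul_nonneg (h0 _ _) (h0 _ _))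
      have := (abs_le.1 (hosc i j p.1 p.2 h h')).2
      linarith
    · rw [mul_comm]
      exact mul_le_mul_of_nonneg_right (abs_le.1 (hM p)).2 (r0 p)
  have lo : ∑ i, ∑ j, m i j * (c (z i, z j) - ε) ≤ ∫ p, c p ∂π := by
    have e : ∑ i, ∑ j, m i j * (c (z i, z j) - ε) =
        ∫ p, (∑ i, ∑ j, (c (z i, z j) - ε) * (φ i p.1 * φ j p.2)) ∂π := by
      rw [integral_finsetSum _ fun i _ => av_int _ (by fun_prop)]
      refine Finset.sum_congr rfl fun i _ => ?_
      rw [integral_finsetSum _ fun i _ => av_int _ (by fun_prop)]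
      refine Finset.sum_congr rfl fun j _ => ?_
      rw [integral_const_mul, ← hm, mul_comm]
    rw [e]
    refine integral_mono (av_int _ (by fun_prop)) (av_int _ (by fun_prop)) fun p => ?_
    have : c p = ∑ i, ∑ j, c p * (φ i p.1 * φ j p.2) := by
      simp only [← Finset.mul_sum, hs, mul_one]
    simp only []
    rw [this]
    refine Finset.sum_le_sum fun i _ => Finset.sum_le_sum fun j _ => ?_
    by_cases h : φ i p.1 = 0
    · simp [h]
    by_cases h' : φ j p.2 = 0
    · simp [h']
    refine mul_le_mul_of_nonneg_right ?_ (mul_nonneg (h0 _ _) (h0 _ _))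
    have := (abs_le.1 (hosc i j p.1 p.2 h h')).1
    linarith
  have sm : ∑ i, ∑ j, m i j = 1 := by simp only [hma, sa]
  have S1 : ∑ i, ∑ j, m i j * (c (z i, z j) + ε) = ∑ i, ∑ j, m i j * c (z i, z j) + ε := by
    simp only [mul_add, Finset.sum_add_distrib, ← Finset.sum_mul, sm, one_mul]
  have S2 : ∑ i, ∑ j, m i j * (c (z i, z j) - ε) = ∑ i, ∑ j, m i j * c (z i, z j) - ε := by
    simp only [mul_sub, Finset.sum_sub_distrib, ← Finset.sum_mul, sm, one_mul]
  have S3 : -M ≤ ∑ i, ∑ j, m i j * c (z i, z j) := by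
    have : -M = ∑ i, ∑ j, m i j * (-M) := by simp only [← Finset.sum_mul, sm, one_mul]
    rw [this]
    exact Finset.sum_le_sum fun i _ => Finset.sum_le_sum fun j _ =>
      mul_le_mul_of_nonneg_left (abs_le.1 (hM _)).1 (m0 i j)
  rw [S1] at up
  rw [S2] at lo
  nlinarith

lemma av_prob {Z : Type*} [MeasurableSpace Z] (π : Measure (Z × Z)) (α : Measure Z)
    [IsProbabilityMeasure α] (h : π.map Prod.fst = α) : IsProbabilityMeasure π := by
  constructor
  have : (π.map Prod.fst) Set.univ = 1 := by rw [h]; exact measure_univ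
  rwa [Measure.map_apply measurable_fst MeasurableSet.univ] at this

lemma av_transport {Z : Type*} [MetricSpace Z] [CompactSpace Z] [MeasurableSpace Z] [BorelSpace Z]
    (c : Z × Z → ℝ) (hc : Continuous c) :
    Continuous fun p : ProbabilityMeasure Z × ProbabilityMeasure Z =>
      transportCost c (p.1 : Measure Z) (p.2 : Measure Z) := by
  obtain ⟨M, hM⟩ : ∃ M, ∀ p, |c p| ≤ M := by
    obtain ⟨M, hM⟩ := isCompact_univ.exists_bound_of_continuousOn hc.continuousOn
    exact ⟨M, fun p => hM p (Set.mem_univ p)⟩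
  have ne : ∀ p : ProbabilityMeasure Z × ProbabilityMeasure Z,
      { v : ℝ | ∃ π : Measure (Z × Z), π.map Prod.fst = (p.1 : Measure Z) ∧
        π.map Prod.snd = (p.2 : Measure Z) ∧ v = ∫ p, c p ∂π }.Nonempty := fun p =>
    ⟨_, (p.1 : Measure Z).prod (p.2 : Measure Z), by simp, by simp, rfl⟩
  have bdd : ∀ p : ProbabilityMeasure Z × ProbabilityMeasure Z,
      BddBelow { v : ℝ | ∃ π : Measure (Z × Z), π.map Prod.fst = (p.1 : Measure Z) ∧
        π.map Prod.snd = (p.2 : Measure Z) ∧ v = ∫ p, c p ∂π } := by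
    refine fun p => ⟨-M, ?_⟩
    rintro v ⟨π, h1, -, rfl⟩
    have := av_prob π _ h1
    have : ∫ _p, (-M) ∂π ≤ ∫ p, c p ∂π :=
      integral_mono (av_int _ (by fun_prop)) (av_int _ hc) fun p => (abs_le.1 (hM p)).1
    simpa using this
  rw [continuous_iff_continuousAt]
  intro p₀
  refine tendsto_order.2 ⟨fun y hy => ?_, fun y hy => ?_⟩
  · obtain ⟨t, hyt, ht⟩ := exists_between hy
    let F : ProbabilityMeasure (Z × Z) → ProbabilityMeasure Z × ProbabilityMeasure Z :=
      fun π => (π.map measurable_fst.aemeasurable, π.map measurable_snd.aemeasurable)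
    have hF : Continuous F := (ProbabilityMeasure.continuous_map continuous_fst).prodMk
      (ProbabilityMeasure.continuous_map continuous_snd)
    have hI : Continuous fun π : ProbabilityMeasure (Z × Z) => ∫ p, c p ∂(π : Measure (Z × Z)) :=
      ProbabilityMeasure.continuous_integral_continuousMap (⟨c, hc⟩ : C(Z × Z, ℝ))
    have hcl : IsClosed (F '' {π | ∫ p, c p ∂(π : Measure (Z × Z)) ≤ t}) :=
      ((isClosed_le hI continuous_const).isCompact.image hF).isClosed
    have hmem : p₀ ∉ F '' {π | ∫ p, c p ∂(π : Measure (Z × Z)) ≤ t} := by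
      rintro ⟨π, hπ, rfl⟩
      refine absurd ht (not_lt.2 (le_trans (csInf_le (bdd _) ⟨π, ?_, ?_, rfl⟩) hπ))
      · rfl
      · rfl
    filter_upwards [hcl.isOpen_compl.mem_nhds hmem] with p hp
    refine lt_of_lt_of_le hyt (le_csInf (ne p) ?_)
    rintro v ⟨π, h1, h2, rfl⟩
    by_contra hlt
    have := av_prob π _ h1
    refine hp ⟨⟨π, this⟩, (not_le.1 hlt).le, Prod.ext (Subtype.ext h1) (Subtype.ext h2)⟩
  · obtain ⟨v, ⟨π, h1, h2, rfl⟩, hv⟩ := exists_lt_of_csInf_lt (ne p₀) hy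
    have hπ := av_prob π _ h1
    have M0 : 0 ≤ M := (abs_nonneg _).trans (hM (p₀.1.nonempty.some, p₀.1.nonempty.some))
    obtain ⟨ε, hε, hε1, hεy⟩ : ∃ ε : ℝ, 0 < ε ∧ ε < 1 ∧ ∫ p, c p ∂π + (2 + 2 * M) * ε < y := by
      have hd : 0 < (y - ∫ p, c p ∂π) / (2 + 2 * M) := div_pos (by linarith) (by linarith)
      obtain ⟨ε, h1, h2⟩ := exists_between (lt_min hd one_pos)
      refine ⟨ε, h1, h2.trans_le (min_le_right _ _), ?_⟩
      have := (lt_div_iff₀ (by linarith)).1 (h2.trans_le (min_le_left _ _))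
      linarith
    obtain ⟨δ, hδ, hcδ⟩ := Metric.uniformContinuous_iff.1
      (CompactSpace.uniformContinuous_of_continuous hc) ε hε
    obtain ⟨t, φ, hφ, φ0, φs, φd⟩ := av_pou (Z := Z) δ hδ
    have ev : ∀ (q : ProbabilityMeasure Z × ProbabilityMeasure Z → ProbabilityMeasure Z)
        (_ : Continuous q), ∀ᶠ p in 𝓝 p₀, ∀ i, (1 - ε) * ∫ x, φ i x ∂(q p₀ : Measure Z) ≤
          ∫ x, φ i x ∂(q p : Measure Z) := by
      intro q hq
      rw [eventually_all]
      intro i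
      have hcon : Continuous fun p => ∫ x, φ i x ∂(q p : Measure Z) :=
        (ProbabilityMeasure.continuous_integral_continuousMap
          (⟨φ i, hφ i⟩ : C(Z, ℝ))).comp hq
      have hnn : ∀ p, 0 ≤ ∫ x, φ i x ∂(q p : Measure Z) := fun p =>
        integral_nonneg fun x => φ0 i x
      rcases (hnn p₀).eq_or_lt with h | h
      · rw [← h]
        exact Eventually.of_forall fun p => by simpa using hnn p
      · have hlt : (1 - ε) * ∫ x, φ i x ∂(q p₀ : Measure Z) < ∫ x, φ i x ∂(q p₀ : Measure Z) := by
          nlinarith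
        exact ((hcon.tendsto p₀).eventually (lt_mem_nhds hlt)).mono fun p hp => hp.le
    filter_upwards [ev Prod.fst continuous_fst, ev Prod.snd continuous_snd] with p e1 e2
    rw [← h1] at e1
    rw [← h2] at e2
    obtain ⟨π', g1, g2, g3⟩ := av_key c hc M ε hM hε hε1 φ hφ φ0 φs (fun i => (i : Z))
      (fun i j x y hx hy => by
        have : dist (x, y) ((i : Z), (j : Z)) < δ := by
          rw [Prod.dist_eq]; exact max_lt (φd i x hx) (φd j y hy)
        have := hcδ this
        rw [Real.dist_eq] at this
        exact this.le) π p.1 p.2 e1 e2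
    exact (csInf_le (bdd p) ⟨π', g1, g2, rfl⟩).trans_lt (g3.trans_lt hεy)

theorem alignVal_continuous
    {X Z Θ : Type*}
    [MetricSpace X] [CompactSpace X] [MeasurableSpace X] [BorelSpace X]
    [MetricSpace Z] [CompactSpace Z] [MeasurableSpace Z] [BorelSpace Z]
    [MetricSpace Θ] [CompactSpace Θ] [Nonempty Θ]
    (T : Θ → X → Z) (hT : Continuous fun p : Θ × X => T p.1 p.2)
    (c : Z × Z → ℝ) (hc : Continuous c)
    (R : Θ → ℝ) (hR : Continuous R) :
    Continuous (fun p : ProbabilityMeasure X × ProbabilityMeasure Z =>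
      alignVal c T R (p.1 : Measure X) (p.2 : Measure Z)) := by
  let _ : MeasurableSpace Θ := borel Θ
  have _ : BorelSpace Θ := ⟨rfl⟩
  have hTm : ∀ θ, Measurable (T θ) := fun θ =>
    (hT.comp (Continuous.prodMk_right θ)).measurable
  have hG : Continuous fun q : ProbabilityMeasure X × Θ =>
      (q.1.map (hTm q.2).aemeasurable : ProbabilityMeasure Z) := by
    have h := (ProbabilityMeasure.continuous_map hT).comp
      ((ProbabilityMeasure.continuous_prod (α := Θ) (β := X)).comp
        ((continuous_diracProba.comp continuous_snd).prodMk
          (continuous_fst (X := ProbabilityMeasure X) (Y := Θ))))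
    convert h using 1
    funext q
    apply Subtype.ext
    change (q.1 : Measure X).map (T q.2) =
      ((Measure.dirac q.2).prod (q.1 : Measure X)).map (fun p : Θ × X => T p.1 p.2)
    rw [Measure.dirac_prod, Measure.map_map hT.measurable (by fun_prop)]
    rfl
  have hW : Continuous fun q : (ProbabilityMeasure X × ProbabilityMeasure Z) × Θ =>
      transportCost c ((q.1.1 : Measure X).map (T q.2)) (q.1.2 : Measure Z) + R q.2 := by
    refine Continuous.add ?_ (hR.comp continuous_snd)
    exact (av_transport c hc).comp
      ((hG.comp ((continuous_fst.comp continuous_fst).prodMk continuous_snd)).prodMk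
        (continuous_snd.comp continuous_fst))
  have := (isCompact_univ (X := Θ)).continuous_sInf (f := fun
    (p : ProbabilityMeasure X × ProbabilityMeasure Z) (θ : Θ) =>
      transportCost c ((p.1 : Measure X).map (T θ)) (p.2 : Measure Z) + R θ) hW
  simpa only [alignVal, iInf, Set.image_univ] using this
end

section
/- Stability of optimal parameters: Under the compact setup, suppose μ_k → μ_∞ weakly in P(X) and ν_k → ν_∞ weakly in P(Z), and for each k let θ_k ∈ Θ be optimal for W_c^{↓,R}(μ_k, ν_k). Then every limit point θ_∞ ∈ Θ of the sequence (θ_k) is optimal for W_c^{↓,R}(μ_∞, ν_∞). -/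
open MeasureTheory Filter

section helpers
open Topology

lemma ops_integrable {Y : Type*} [MetricSpace Y] [CompactSpace Y] [MeasurableSpace Y]
    [BorelSpace Y] (μ : Measure Y) [IsFiniteMeasure μ] {f : Y → ℝ} (hf : Continuous f) :
    Integrable f μ :=
  (BoundedContinuousFunction.mkOfCompact ⟨f, hf⟩).integrable μ

lemma ops_bound {Y : Type*} [MetricSpace Y] [CompactSpace Y] {f : Y → ℝ} (hf : Continuous f) :
    ∃ C : ℝ, 0 ≤ C ∧ ∀ y, |f y| ≤ C :=
  ⟨‖BoundedContinuousFunction.mkOfCompact ⟨f, hf⟩‖, norm_nonneg _, fun y =>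
    (BoundedContinuousFunction.mkOfCompact ⟨f, hf⟩).norm_coe_le_norm y⟩

variable {Z : Type*} [MetricSpace Z] [CompactSpace Z] [MeasurableSpace Z] [BorelSpace Z]

lemma ops_coupling_prob {α : Measure Z} [IsProbabilityMeasure α] {π : Measure (Z × Z)}
    (h : π.map Prod.fst = α) : IsProbabilityMeasure π := by
  subst h
  constructor
  have := measure_univ (μ := π.map Prod.fst)
  rwa [Measure.map_apply measurable_fst MeasurableSet.univ, Set.preimage_univ] at this

lemma ops_lower {c : Z × Z → ℝ} {C : ℝ} (hC : ∀ p, |c p| ≤ C) (hc : Continuous c)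
    {π : Measure (Z × Z)} [IsProbabilityMeasure π] : -C ≤ ∫ p, c p ∂π := by
  have h := integral_mono (μ := π) (f := fun _ => -C) (g := c) (integrable_const _)
    (ops_integrable π hc) (fun p => (abs_le.1 (hC p)).1)
  simpa using h

lemma ops_bddBelow {c : Z × Z → ℝ} (hc : Continuous c) (α β : Measure Z)
    [IsProbabilityMeasure α] :
    BddBelow { v : ℝ | ∃ π : Measure (Z × Z),
    π.map Prod.fst = α ∧ π.map Prod.snd = β ∧ v = ∫ p, c p ∂π } := by
  obtain ⟨C, -, hC⟩ := ops_bound hc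
  refine ⟨-C, ?_⟩
  rintro v ⟨π, h1, h2, rfl⟩
  have := ops_coupling_prob h1
  exact ops_lower hC hc

lemma ops_nonempty (c : Z × Z → ℝ) (α β : Measure Z)
    [IsProbabilityMeasure α] [IsProbabilityMeasure β] :
    { v : ℝ | ∃ π : Measure (Z × Z),
    π.map Prod.fst = α ∧ π.map Prod.snd = β ∧ v = ∫ p, c p ∂π }.Nonempty :=
  ⟨_, α.prod β, by simp [Measure.map_fst_prod], by simp [Measure.map_snd_prod], rfl⟩

lemma ops_cost_le {c : Z × Z → ℝ} (hc : Continuous c) {α β : Measure Z}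
    [IsProbabilityMeasure α] {π : Measure (Z × Z)}
    (h1 : π.map Prod.fst = α) (h2 : π.map Prod.snd = β) :
    transportCost c α β ≤ ∫ p, c p ∂π :=
  csInf_le (ops_bddBelow hc α β) ⟨π, h1, h2, rfl⟩

lemma ops_cost_ge {c : Z × Z → ℝ} (hc : Continuous c) {C : ℝ} (hC : ∀ p, |c p| ≤ C)
    (α β : Measure Z) [IsProbabilityMeasure α] [IsProbabilityMeasure β] :
    -C ≤ transportCost c α β := by
  refine le_csInf (ops_nonempty c α β) ?_
  rintro v ⟨π, h1, h2, rfl⟩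
  have := ops_coupling_prob h1
  exact ops_lower hC hc

lemma ops_density {c : Z × Z → ℝ} (hc : Continuous c) (α β : Measure Z)
    [IsProbabilityMeasure α] [IsProbabilityMeasure β] (h : Z × Z → ℝ) (hh : Continuous h)
    (h0 : ∀ p, 0 ≤ h p) (h1 : ∀ x, ∫ y, h (x, y) ∂β = 1) (h2 : ∀ y, ∫ x, h (x, y) ∂α = 1) :
    transportCost c α β ≤ ∫ p, h p * c p ∂(α.prod β) := by
  have hm : Measurable (fun p => ENNReal.ofReal (h p)) := hh.measurable.ennreal_ofReal
  have e1 : ∀ x, ∫⁻ y, ENNReal.ofReal (h (x, y)) ∂β = 1 := fun x => by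
    rw [← ofReal_integral_eq_lintegral_ofReal (ops_integrable β (by fun_prop))
      (Eventually.of_forall fun y => h0 _), h1, ENNReal.ofReal_one]
  have e2 : ∀ y, ∫⁻ x, ENNReal.ofReal (h (x, y)) ∂α = 1 := fun y => by
    rw [← ofReal_integral_eq_lintegral_ofReal (ops_integrable α (by fun_prop))
      (Eventually.of_forall fun y => h0 _), h2, ENNReal.ofReal_one]
  have key : ∫ p, c p ∂((α.prod β).withDensity fun p => ENNReal.ofReal (h p))
      = ∫ p, h p * c p ∂(α.prod β) := by
    rw [integral_withDensity_eq_integral_toReal_smul hm (by simp)]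
    simp [ENNReal.toReal_ofReal (h0 _)]
  rw [← key]
  apply ops_cost_le hc
  · ext s hs
    rw [Measure.map_apply measurable_fst hs, withDensity_apply _ (measurable_fst hs),
      ← Set.prod_univ, ← Measure.prod_restrict, lintegral_prod _ hm.aemeasurable]
    simp [e1]
  · ext s hs
    rw [Measure.map_apply measurable_snd hs, withDensity_apply _ (measurable_snd hs),
      ← Set.univ_prod, ← Measure.prod_restrict, lintegral_prod_symm _ hm.aemeasurable]
    simp [e2]

lemma ops_subcoupling {c : Z × Z → ℝ} (hc : Continuous c) {C : ℝ} (hC : ∀ p, |c p| ≤ C)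
    (α β : Measure Z) [IsProbabilityMeasure α] [IsProbabilityMeasure β]
    (g : Z × Z → ℝ) (hg : Continuous g) (g0 : ∀ p, 0 ≤ g p) (G1 G2 : Z → ℝ)
    (hG1 : Continuous G1) (hG2 : Continuous G2)
    (h1 : ∀ x, ∫ y, g (x, y) ∂β = G1 x) (h2 : ∀ y, ∫ x, g (x, y) ∂α = G2 y)
    (l1 : ∀ x, G1 x ≤ 1) (l2 : ∀ x, G2 x ≤ 1) (s : ℝ) (hs : s < 1)
    (s1 : ∫ x, G1 x ∂α = s) (s2 : ∫ x, G2 x ∂β = s) :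
    transportCost c α β ≤ ∫ p, g p * c p ∂(α.prod β) + C * (1 - s) := by
  have hs' : (1 - s) ≠ 0 := by linarith
  have hs0 : 0 < 1 - s := by linarith
  have I1 : ∫ x, (1 - G1 x) ∂α = 1 - s := by
    rw [integral_sub (integrable_const _) (ops_integrable α hG1), s1]; simp
  have I2 : ∫ x, (1 - G2 x) ∂β = 1 - s := by
    rw [integral_sub (integrable_const _) (ops_integrable β hG2), s2]; simp
  let r : Z × Z → ℝ := fun p => (1 - G1 p.1) * (1 - G2 p.2) / (1 - s)
  have r0 : ∀ p, 0 ≤ r p := fun p =>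
    div_nonneg (mul_nonneg (by linarith [l1 p.1]) (by linarith [l2 p.2])) hs0.le
  have hr : Continuous r := by fun_prop
  have Ir : ∫ p, r p ∂(α.prod β) = 1 - s := by
    simp only [r]
    rw [integral_div, integral_prod_mul (fun x => 1 - G1 x) (fun y => 1 - G2 y), I1, I2]
    field_simp
  refine (ops_density hc α β (fun p => g p + r p) (by fun_prop)
    (fun p => add_nonneg (g0 p) (r0 p)) ?_ ?_).trans ?_
  · intro x
    rw [integral_add (ops_integrable β (by fun_prop)) (ops_integrable β (by fun_prop)), h1]
    simp only [r]
    rw [integral_div, integral_const_mul, I2]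
    field_simp; ring
  · intro y
    rw [integral_add (ops_integrable α (by fun_prop)) (ops_integrable α (by fun_prop)), h2]
    simp only [r]
    rw [integral_div, integral_mul_const, I1]
    field_simp; ring
  · simp only [add_mul]
    rw [integral_add (ops_integrable _ (by fun_prop)) (ops_integrable _ (by fun_prop))]
    gcongr
    rw [← Ir, ← integral_const_mul]
    refine integral_mono (ops_integrable _ (by fun_prop)) (ops_integrable _ (by fun_prop)) ?_
    intro p
    have := (abs_le.1 (hC p)).2
    have := r0 p
    show r p * c p ≤ C * r p
    nlinarith

lemma ops_partition {Z : Type*} [MetricSpace Z] [CompactSpace Z] {δ : ℝ} (hδ : 0 < δ) : ∃ (t : Finset Z) (φ : Z → Z → ℝ),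
    (∀ i, Continuous (φ i)) ∧ (∀ i x, 0 ≤ φ i x) ∧ (∀ x, ∑ i ∈ t, φ i x = 1) ∧
    (∀ i x, φ i x ≠ 0 → dist x i < δ) := by
  obtain ⟨t, -, ht⟩ := isCompact_univ (X := Z).elim_nhds_subcover (fun x => Metric.ball x δ)
    (fun x _ => Metric.ball_mem_nhds x hδ)
  let f : Z → Z → ℝ := fun i x => max 0 (δ - dist x i)
  have f0 : ∀ i x, 0 ≤ f i x := fun i x => le_max_left _ _
  have fc : ∀ i, Continuous (f i) := fun i => by fun_prop
  have fs : ∀ x, 0 < ∑ i ∈ t, f i x := by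
    intro x
    have hx := ht (Set.mem_univ x)
    simp only [Set.mem_iUnion, Metric.mem_ball] at hx
    obtain ⟨i, hi, hxi⟩ := hx
    exact Finset.sum_pos' (fun i _ => f0 i x) ⟨i, hi, lt_max_of_lt_right (by linarith)⟩
  refine ⟨t, fun i x => f i x / ∑ j ∈ t, f j x, ?_, ?_, ?_, ?_⟩
  · intro i
    exact (fc i).div (continuous_finsetSum _ fun j _ => fc j) (fun x => (fs x).ne')
  · intro i x
    exact div_nonneg (f0 i x) (fs x).le
  · intro x
    rw [← Finset.sum_div, div_self (fs x).ne']
  · intro i x h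
    by_contra hd
    apply h
    have : f i x = 0 := max_eq_left (by linarith)
    simp [this]

lemma ops_upper_aux {c : Z × Z → ℝ} (hc : Continuous c) {C : ℝ} (hC : ∀ p, |c p| ≤ C)
    (α β : Measure Z) [IsProbabilityMeasure α] [IsProbabilityMeasure β]
    (π : Measure (Z × Z)) [IsProbabilityMeasure π]
    (t : Finset Z) (φ : Z → Z → ℝ) (φc : ∀ i, Continuous (φ i)) (φ0 : ∀ i x, 0 ≤ φ i x)
    (φ1 : ∀ x, ∑ i ∈ t, φ i x = 1) (η : ℝ)
    (hη : ∀ i j x y, φ i x ≠ 0 → φ j y ≠ 0 → |c (x, y) - c (i, j)| ≤ η)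
    (s : ℝ) (s0 : 0 < s) (s1 : s < 1)
    (ha : ∀ i ∈ t, s * ∫ p, φ i p.1 ∂π ≤ ∫ x, φ i x ∂α)
    (hb : ∀ i ∈ t, s * ∫ p, φ i p.2 ∂π ≤ ∫ x, φ i x ∂β) :
    transportCost c α β ≤ s * (∫ p, c p ∂π + 2 * η) + C * (1 - s) := by
  set A : Z → ℝ := fun i => ∫ p, φ i p.1 ∂π with hA
  set B : Z → ℝ := fun i => ∫ p, φ i p.2 ∂π with hB
  set a : Z → ℝ := fun i => ∫ x, φ i x ∂α with ha'
  set b : Z → ℝ := fun i => ∫ x, φ i x ∂β with hb'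
  set w : Z → Z → ℝ := fun i j => ∫ p, φ i p.1 * φ j p.2 ∂π with hw
  have w0 : ∀ i j, 0 ≤ w i j := fun i j => integral_nonneg fun p => mul_nonneg (φ0 _ _) (φ0 _ _)
  have a0 : ∀ i, 0 ≤ a i := fun i => integral_nonneg fun p => φ0 _ _
  have b0 : ∀ i, 0 ≤ b i := fun i => integral_nonneg fun p => φ0 _ _
  have A0 : ∀ i, 0 ≤ A i := fun i => integral_nonneg fun p => φ0 _ _
  have B0 : ∀ i, 0 ≤ B i := fun i => integral_nonneg fun p => φ0 _ _
  have wA : ∀ i, ∑ j ∈ t, w i j = A i := by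
    intro i
    simp only [hw, hA]
    rw [← integral_finsetSum _ (fun j _ => ops_integrable π (by fun_prop))]
    simp only [← Finset.mul_sum, φ1, mul_one]
  have wB : ∀ j, ∑ i ∈ t, w i j = B j := by
    intro j
    simp only [hw, hB]
    rw [← integral_finsetSum _ (fun j _ => ops_integrable π (by fun_prop))]
    simp only [← Finset.sum_mul, φ1, one_mul]
  have A1 : ∑ i ∈ t, A i = 1 := by
    simp only [hA]
    rw [← integral_finsetSum _ (fun j _ => ops_integrable π (by fun_prop))]
    simp [φ1]
  have B1 : ∑ i ∈ t, B i = 1 := by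
    simp only [hB]
    rw [← integral_finsetSum _ (fun j _ => ops_integrable π (by fun_prop))]
    simp [φ1]
  have Aa : ∀ i ∈ t, a i = 0 → A i = 0 := fun i hi h => by
    have h1 : s * A i ≤ a i := ha i hi
    have := A0 i
    nlinarith
  have Bb : ∀ i ∈ t, b i = 0 → B i = 0 := fun i hi h => by
    have h1 : s * B i ≤ b i := hb i hi
    have := B0 i
    nlinarith
  have wa : ∀ i ∈ t, ∀ j ∈ t, a i = 0 → w i j = 0 := fun i hi j hj h => by
    have h1 := Finset.single_le_sum (f := fun j => w i j) (fun j _ => w0 i j) hj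
    rw [wA, Aa i hi h] at h1
    exact le_antisymm h1 (w0 i j)
  have wb : ∀ i ∈ t, ∀ j ∈ t, b j = 0 → w i j = 0 := fun i hi j hj h => by
    have h1 := Finset.single_le_sum (f := fun i => w i j) (fun i _ => w0 i j) hi
    rw [wB, Bb j hj h] at h1
    exact le_antisymm h1 (w0 i j)
  let g : Z × Z → ℝ := fun p =>
    s * ∑ i ∈ t, ∑ j ∈ t, w i j / (a i * b j) * (φ i p.1 * φ j p.2)
  have hg : Continuous g := by fun_prop
  have e1 : ∀ i ∈ t, A i / a i * a i = A i := fun i hi => by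
    by_cases h : a i = 0
    · simp [h, Aa i hi h]
    · field_simp
  have e2 : ∀ i ∈ t, B i / b i * b i = B i := fun i hi => by
    by_cases h : b i = 0
    · simp [h, Bb i hi h]
    · field_simp
  have key := ops_subcoupling hc hC α β g hg
    (fun p => mul_nonneg s0.le (Finset.sum_nonneg fun i _ => Finset.sum_nonneg fun j _ =>
      mul_nonneg (div_nonneg (w0 i j) (mul_nonneg (a0 i) (b0 j)))
        (mul_nonneg (φ0 _ _) (φ0 _ _))))
    (fun x => ∑ i ∈ t, s * (A i / a i) * φ i x) (fun x => ∑ i ∈ t, s * (B i / b i) * φ i x)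
    (by fun_prop) (by fun_prop) ?_ ?_ ?_ ?_ s s1 ?_ ?_
  · refine key.trans ?_
    gcongr
    simp only [g, mul_assoc]
    rw [integral_const_mul]
    refine mul_le_mul_of_nonneg_left ?_ s0.le
    have R : ∫ p, c p ∂π + 2 * η = ∑ i ∈ t, ∑ j ∈ t,
        (∫ p, φ i p.1 * φ j p.2 * c p ∂π + 2 * η * w i j) := by
      simp only [Finset.sum_add_distrib, ← Finset.mul_sum, wA, A1, mul_one]
      congr 1
      have : ∀ i ∈ t, ∑ j ∈ t, ∫ p, φ i p.1 * φ j p.2 * c p ∂π = ∫ p, φ i p.1 * c p ∂π := by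
        intro i _
        rw [← integral_finsetSum _ (fun j _ => ops_integrable π (by fun_prop))]
        simp only [← Finset.sum_mul, ← Finset.mul_sum, φ1, mul_one]
      rw [Finset.sum_congr rfl this,
        ← integral_finsetSum _ (fun j _ => ops_integrable π (by fun_prop))]
      simp only [← Finset.sum_mul, φ1, one_mul]
    rw [R]
    simp only [Finset.sum_mul]
    rw [integral_finsetSum _ (fun i _ => ops_integrable _ (by fun_prop))]
    refine Finset.sum_le_sum fun i hi => ?_
    rw [integral_finsetSum _ (fun i _ => ops_integrable _ (by fun_prop))]
    refine Finset.sum_le_sum fun j hj => ?_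
    have P : ∀ p : Z × Z, φ i p.1 * φ j p.2 * c p ≤ (c (i, j) + η) * (φ i p.1 * φ j p.2) ∧
        (c (i, j) - η) * (φ i p.1 * φ j p.2) ≤ φ i p.1 * φ j p.2 * c p := by
      intro p
      by_cases h1 : φ i p.1 = 0
      · simp [h1]
      by_cases h2 : φ j p.2 = 0
      · simp [h2]
      have h := abs_le.1 (hη i j p.1 p.2 h1 h2)
      have h0 := mul_nonneg (φ0 i p.1) (φ0 j p.2)
      have hp : c (p.1, p.2) = c p := rfl
      rw [hp] at h
      constructor <;> nlinarith
    have P1 : ∫ p, φ i p.1 * φ j p.2 * c p ∂(α.prod β) ≤ (c (i, j) + η) * (a i * b j) := by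
      have := integral_mono (μ := α.prod β) (ops_integrable _ (by fun_prop))
        (ops_integrable _ (by fun_prop)) (fun p => (P p).1)
      rwa [integral_const_mul, integral_prod_mul (φ i) (φ j)] at this
    have P2 : (c (i, j) - η) * w i j ≤ ∫ p, φ i p.1 * φ j p.2 * c p ∂π := by
      have := integral_mono (μ := π) (ops_integrable _ (by fun_prop))
        (ops_integrable _ (by fun_prop)) (fun p => (P p).2)
      rwa [integral_const_mul] at this
    have P3 : ∫ p, w i j / (a i * b j) * (φ i p.1 * φ j p.2) * c p ∂(α.prod β)
        ≤ (c (i, j) + η) * w i j := by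
      simp only [mul_assoc] at P1 ⊢
      rw [integral_const_mul]
      refine (mul_le_mul_of_nonneg_left P1
        (div_nonneg (w0 i j) (mul_nonneg (a0 i) (b0 j)))).trans (le_of_eq ?_)
      by_cases h1 : a i = 0
      · simp [wa i hi j hj h1]
      by_cases h2 : b j = 0
      · simp [wb i hi j hj h2]
      field_simp
    simp only [mul_assoc] at P2 P3 ⊢
    linarith
  · intro x
    simp only [g]
    rw [integral_const_mul, integral_finsetSum _ (fun i _ => ops_integrable _ (by fun_prop)),
      Finset.mul_sum]
    refine Finset.sum_congr rfl fun i hi => ?_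
    rw [integral_finsetSum _ (fun i _ => ops_integrable _ (by fun_prop)), mul_assoc, ← wA i,
      Finset.sum_div, Finset.sum_mul]
    congr 1
    refine Finset.sum_congr rfl fun j hj => ?_
    rw [integral_const_mul, integral_const_mul]
    change w i j / (a i * b j) * (φ i x * b j) = _
    by_cases h1 : a i = 0
    · simp [wa i hi j hj h1]
    by_cases h2 : b j = 0
    · simp [wb i hi j hj h2]
    field_simp
  · intro x
    simp only [g]
    simp only [Finset.sum_comm (s := t) (t := t) (f := fun i j => _ * (_ * φ j x))]
    rw [integral_const_mul, integral_finsetSum _ (fun i _ => ops_integrable _ (by fun_prop)),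
      Finset.mul_sum]
    refine Finset.sum_congr rfl fun j hj => ?_
    rw [integral_finsetSum _ (fun i _ => ops_integrable _ (by fun_prop)), mul_assoc, ← wB j,
      Finset.sum_div, Finset.sum_mul]
    congr 1
    refine Finset.sum_congr rfl fun i hi => ?_
    rw [integral_const_mul, integral_mul_const]
    change w i j / (a i * b j) * (a i * φ j x) = _
    by_cases h1 : a i = 0
    · simp [wa i hi j hj h1]
    by_cases h2 : b j = 0
    · simp [wb i hi j hj h2]
    field_simp
  · intro x
    rw [← φ1 x]
    refine Finset.sum_le_sum fun i hi => ?_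
    have h : s * (A i / a i) ≤ 1 := by
      rw [← mul_div_assoc]
      exact div_le_one_of_le₀ (ha i hi) (a0 i)
    have := φ0 i x
    nlinarith
  · intro x
    rw [← φ1 x]
    refine Finset.sum_le_sum fun i hi => ?_
    have h : s * (B i / b i) ≤ 1 := by
      rw [← mul_div_assoc]
      exact div_le_one_of_le₀ (hb i hi) (b0 i)
    have := φ0 i x
    nlinarith
  · rw [integral_finsetSum _ (fun i _ => ops_integrable _ (by fun_prop))]
    simp only [integral_const_mul, mul_assoc]
    rw [← Finset.mul_sum, Finset.sum_congr rfl e1, A1, mul_one]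
  · rw [integral_finsetSum _ (fun i _ => ops_integrable _ (by fun_prop))]
    simp only [integral_const_mul, mul_assoc]
    rw [← Finset.mul_sum, Finset.sum_congr rfl e2, B1, mul_one]

lemma ops_tendsto_integral {Y κ : Type*} [MetricSpace Y] [CompactSpace Y] [MeasurableSpace Y]
    [BorelSpace Y] {L : Filter κ} {μs : κ → ProbabilityMeasure Y} {μ : ProbabilityMeasure Y}
    (h : Tendsto μs L (𝓝 μ)) {f : Y → ℝ} (hf : Continuous f) :
    Tendsto (fun k => ∫ y, f y ∂(μs k : Measure Y)) L (𝓝 (∫ y, f y ∂(μ : Measure Y))) :=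
  ProbabilityMeasure.tendsto_iff_forall_integral_tendsto.1 h
    (BoundedContinuousFunction.mkOfCompact ⟨f, hf⟩)

lemma ops_upper {c : Z × Z → ℝ} (hc : Continuous c) {κ : Type*} {L : Filter κ}
    {αs βs : κ → ProbabilityMeasure Z} {α β : ProbabilityMeasure Z}
    (hα : Tendsto αs L (𝓝 α)) (hβ : Tendsto βs L (𝓝 β)) {ε : ℝ} (hε : 0 < ε) :
    ∀ᶠ k in L, transportCost c (αs k : Measure Z) (βs k) ≤
      transportCost c (α : Measure Z) β + ε := by
  obtain ⟨v, ⟨π, h1, h2, rfl⟩, hv⟩ := exists_lt_of_csInf_lt (ops_nonempty c (α : Measure Z) β)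
    (lt_add_of_pos_right _ (half_pos hε))
  change _ < transportCost c (α : Measure Z) β + ε / 2 at hv
  have hπ := ops_coupling_prob h1
  obtain ⟨C, C0, hC⟩ := ops_bound hc
  have hpc : |∫ p, c p ∂π| ≤ C := by
    have := norm_integral_le_of_norm_le_const (μ := π) (f := c) (C := C)
      (Eventually.of_forall hC)
    simpa using this
  obtain ⟨δ, hδ, hd⟩ := Metric.uniformContinuous_iff.1
    (CompactSpace.uniformContinuous_of_continuous hc) (ε / 8) (by linarith)
  obtain ⟨t, φ, φc, φ0, φ1, φd⟩ := ops_partition (Z := Z) hδ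
  obtain ⟨s, s0, s1, hs⟩ : ∃ s : ℝ, 0 < s ∧ s < 1 ∧ 2 * C * (1 - s) ≤ ε / 4 := by
    have hx : 0 < ε / (8 * C + 2 * ε) := by positivity
    refine ⟨1 - ε / (8 * C + 2 * ε), ?_, by linarith, ?_⟩
    · rw [sub_pos, div_lt_one (by positivity)]; linarith
    · rw [sub_sub_cancel, mul_div_assoc', div_le_iff₀ (by positivity)]
      nlinarith
  have E : ∀ (γs : κ → ProbabilityMeasure Z) (γ : ProbabilityMeasure Z), Tendsto γs L (𝓝 γ) →
      ∀ᶠ k in L, ∀ i ∈ t, s * ∫ x, φ i x ∂(γ : Measure Z) ≤ ∫ x, φ i x ∂(γs k : Measure Z) := by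
    intro γs γ hγ
    rw [Filter.eventually_all_finset]
    intro i _
    have T := ops_tendsto_integral hγ (φc i)
    have hn : 0 ≤ ∫ x, φ i x ∂(γ : Measure Z) := integral_nonneg fun x => φ0 i x
    rcases hn.eq_or_lt with h | h
    · refine Eventually.of_forall fun k => ?_
      rw [← h, mul_zero]
      exact integral_nonneg fun x => φ0 i x
    · filter_upwards [T.eventually (lt_mem_nhds (show _ < _ by nlinarith :
        s * ∫ x, φ i x ∂(γ : Measure Z) < ∫ x, φ i x ∂(γ : Measure Z)))] with k hk
      exact hk.le
  filter_upwards [E αs α hα, E βs β hβ] with k ka kb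
  have M1 : ∀ i, ∫ x, φ i x ∂(α : Measure Z) = ∫ p, φ i p.1 ∂π := fun i => by
    rw [← h1, integral_map measurable_fst.aemeasurable (φc i).aestronglyMeasurable]
  have M2 : ∀ i, ∫ x, φ i x ∂(β : Measure Z) = ∫ p, φ i p.2 ∂π := fun i => by
    rw [← h2, integral_map measurable_snd.aemeasurable (φc i).aestronglyMeasurable]
  simp only [M1] at ka
  simp only [M2] at kb
  have := ops_upper_aux hc hC (αs k : Measure Z) (βs k) π t φ φc φ0 φ1 (ε / 8) (by
    intro i j x y hx hy
    have := hd (a := (x, y)) (b := (i, j)) (max_lt (φd i x hx) (φd j y hy))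
    exact this.le) s s0 s1 ka kb
  have h3 := (abs_le.1 hpc)
  nlinarith

lemma ops_lower_semi {c : Z × Z → ℝ} (hc : Continuous c) {κ : Type*} (U : Ultrafilter κ)
    {αs βs : κ → ProbabilityMeasure Z} {α β : ProbabilityMeasure Z}
    (hα : Tendsto αs U (𝓝 α)) (hβ : Tendsto βs U (𝓝 β)) {m : κ → ℝ} {M : ℝ}
    (hm : Tendsto m U (𝓝 M))
    (h : ∀ᶠ k in U, transportCost c (αs k : Measure Z) (βs k) ≤ m k) {ε : ℝ} (hε : 0 < ε) :
    transportCost c (α : Measure Z) β ≤ M + ε := by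
  have ex : ∀ k, ∃ π : ProbabilityMeasure (Z × Z),
      π.map measurable_fst.aemeasurable = αs k ∧ π.map measurable_snd.aemeasurable = βs k ∧
      ∫ p, c p ∂(π : Measure (Z × Z)) ≤ transportCost c (αs k : Measure Z) (βs k) + ε := by
    intro k
    obtain ⟨v, ⟨π, h1, h2, rfl⟩, hv⟩ := exists_lt_of_csInf_lt
      (ops_nonempty c (αs k : Measure Z) (βs k)) (lt_add_of_pos_right _ hε)
    exact ⟨⟨π, ops_coupling_prob h1⟩, Subtype.ext h1, Subtype.ext h2, hv.le⟩
  choose π h1 h2 h3 using ex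
  obtain ⟨ρ, -, hρ⟩ := isCompact_univ (X := ProbabilityMeasure (Z × Z)).ultrafilter_le_nhds
    (U.map π) (by simp)
  have hρ' : Tendsto π U (𝓝 ρ) := hρ
  have e1 : ρ.map measurable_fst.aemeasurable = α := by
    have := ProbabilityMeasure.tendsto_map_of_tendsto_of_continuous π ρ hρ'
      (continuous_fst (X := Z) (Y := Z))
    simp only [h1] at this
    exact tendsto_nhds_unique this hα
  have e2 : ρ.map measurable_snd.aemeasurable = β := by
    have := ProbabilityMeasure.tendsto_map_of_tendsto_of_continuous π ρ hρ'
      (continuous_snd (X := Z) (Y := Z))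
    simp only [h2] at this
    exact tendsto_nhds_unique this hβ
  have e1' : (ρ : Measure (Z × Z)).map Prod.fst = (α : Measure Z) := congrArg Subtype.val e1
  have e2' : (ρ : Measure (Z × Z)).map Prod.snd = (β : Measure Z) := congrArg Subtype.val e2
  refine (ops_cost_le hc e1' e2').trans ?_
  refine le_of_tendsto_of_tendsto (ops_tendsto_integral hρ' hc) (hm.add_const ε) ?_
  filter_upwards [h] with k hk
  linarith [h3 k]

lemma ops_push {X Θ κ : Type*} [MetricSpace X] [CompactSpace X] [MeasurableSpace X] [BorelSpace X]
    [MetricSpace Θ] (T : Θ → X → Z) (hT : Continuous fun p : Θ × X => T p.1 p.2)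
    (hTm : ∀ θ, Measurable (T θ))
    {L : Filter κ} {μs : κ → ProbabilityMeasure X} {μ : ProbabilityMeasure X}
    (hμ : Tendsto μs L (𝓝 μ)) {θs : κ → Θ} {θ : Θ} (hθ : Tendsto θs L (𝓝 θ)) :
    Tendsto (fun k => (μs k).map (hTm (θs k)).aemeasurable) L
      (𝓝 (μ.map (hTm θ).aemeasurable)) := by
  rw [ProbabilityMeasure.tendsto_iff_forall_integral_tendsto]
  intro f
  have hT' : ∀ θ, Continuous (T θ) := fun θ => hT.comp (by fun_prop : Continuous fun x => (θ, x))
  let F : C(Θ, C(X, ℝ)) := ContinuousMap.curry ⟨fun p : Θ × X => f (T p.1 p.2), by fun_prop⟩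
  have e : ∀ (ρ : ProbabilityMeasure X) (τ : Θ),
      ∫ z, f z ∂(ρ.map (hTm τ).aemeasurable : Measure Z) = ∫ x, F τ x ∂(ρ : Measure X) := by
    intro ρ τ
    rw [ProbabilityMeasure.toMeasure_map, integral_map (hTm τ).aemeasurable
      f.continuous.aestronglyMeasurable]
    rfl
  simp only [e]
  have t1 := ops_tendsto_integral hμ (F θ).continuous
  have t2 : Tendsto (fun k => ∫ x, (F (θs k) x - F θ x) ∂(μs k : Measure X)) L (𝓝 0) := by
    have hd : Tendsto (fun k => ‖F (θs k) - F θ‖) L (𝓝 0) := by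
      rw [← tendsto_iff_norm_sub_tendsto_zero]
      exact (F.continuous.tendsto θ).comp hθ
    refine squeeze_zero_norm (fun k => ?_) hd
    have := norm_integral_le_of_norm_le_const (μ := (μs k : Measure X))
      (f := fun x => F (θs k) x - F θ x) (C := ‖F (θs k) - F θ‖)
      (Eventually.of_forall fun x => (F (θs k) - F θ).norm_coe_le_norm x)
    simpa using this
  have := t2.add t1
  rw [zero_add] at this
  refine this.congr fun k => ?_
  rw [← integral_add (ops_integrable _ (by fun_prop)) (ops_integrable _ (by fun_prop))]
  simp

end helpers

/-- Stability of optimal parameters: if `μ_k → μ_∞` and `ν_k → ν_∞` weakly, and `θ_k` is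
optimal for `W_c^{↓,R}(μ_k, ν_k)`, then every limit point `θ_∞` of `(θ_k)` is optimal for
`W_c^{↓,R}(μ_∞, ν_∞)`. -/
theorem optimal_param_stability
    {X Z Θ : Type*}
    [MetricSpace X] [CompactSpace X] [MeasurableSpace X] [BorelSpace X]
    [MetricSpace Z] [CompactSpace Z] [MeasurableSpace Z] [BorelSpace Z]
    [MetricSpace Θ] [CompactSpace Θ] [Nonempty Θ]
    (T : Θ → X → Z) (hT : Continuous fun p : Θ × X => T p.1 p.2)
    (c : Z × Z → ℝ) (hc : Continuous c)
    (R : Θ → ℝ) (hR : Continuous R)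
    (μs : ℕ → ProbabilityMeasure X) (μlim : ProbabilityMeasure X)
    (νs : ℕ → ProbabilityMeasure Z) (νlim : ProbabilityMeasure Z)
    (hμ : Tendsto μs atTop (nhds μlim))
    (hν : Tendsto νs atTop (nhds νlim))
    (θs : ℕ → Θ)
    (hopt : ∀ k, transportCost c ((μs k : Measure X).map (T (θs k))) (νs k : Measure Z)
      + R (θs k) = alignVal c T R (μs k : Measure X) (νs k : Measure Z))
    (θlim : Θ) (hθ : MapClusterPt θlim atTop θs) :
    transportCost c ((μlim : Measure X).map (T θlim)) (νlim : Measure Z) + R θlim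
      = alignVal c T R (μlim : Measure X) (νlim : Measure Z) := by
  have hTc : ∀ θ, Continuous (T θ) := fun θ => hT.comp (by fun_prop : Continuous fun x => (θ, x))
  have hTm : ∀ θ, Measurable (T θ) := fun θ => (hTc θ).measurable
  obtain ⟨C, -, hC⟩ := ops_bound hc
  obtain ⟨D, -, hD⟩ := ops_bound hR
  have bdd : ∀ (μ : ProbabilityMeasure X) (ν : ProbabilityMeasure Z), BddBelow
      (Set.range fun θ => transportCost c ((μ : Measure X).map (T θ)) (ν : Measure Z) + R θ) := by
    rintro μ ν
    refine ⟨-C + -D, ?_⟩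
    rintro _ ⟨θ, rfl⟩
    have := Measure.isProbabilityMeasure_map (μ := (μ : Measure X)) (hTm θ).aemeasurable
    exact add_le_add (ops_cost_ge hc hC _ _) (abs_le.1 (hD θ)).1
  refine le_antisymm (le_ciInf fun θ => ?_) (ciInf_le (bdd μlim νlim) θlim)
  obtain ⟨U, hU, hUθ⟩ := mapClusterPt_iff_ultrafilter.1 hθ
  have hμU := hμ.mono_left hU
  have hνU := hν.mono_left hU
  refine le_of_forall_pos_le_add fun ε hε => ?_
  have up := ops_upper hc (ops_push T hT hTm hμU (tendsto_const_nhds (x := θ))) hνU (half_pos hε)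
  have low := ops_lower_semi hc U (ops_push T hT hTm hμU hUθ) hνU
    (m := fun k => transportCost c ((μlim : Measure X).map (T θ)) (νlim : Measure Z) + ε / 2
      + R θ - R (θs k))
    (tendsto_const_nhds.sub ((hR.tendsto θlim).comp hUθ)) (by
      filter_upwards [up] with k hk
      have h1 := hopt k
      have h2 : alignVal c T R (μs k : Measure X) (νs k : Measure Z) ≤ _ :=
        ciInf_le (bdd (μs k) (νs k)) θ
      simp only [ProbabilityMeasure.toMeasure_map] at hk ⊢
      linarith) (half_pos hε)
  simp only [ProbabilityMeasure.toMeasure_map] at low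
  linarith
end
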